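/- Let k > 0 and n₁ ≥ n₂ be integers, set n = n₁ + n₂ and m = −n₂, and let l be any integer. Let a be a unit of ℂ⟦z⟧, let x_a be the 2×2 matrix over ℂ((z)) with rows (z^{−n}, a·z^{−n−k}) and (0, 1), and let g be the matrix with rows (z^m, z^{l−m}) and (0, z^{−m}). Then x_a⁻¹·g equals the matrix with rows (z^{n+m}, z^{n+l−m} − a·z^{−k−m}) and (0, z^{−m}), and all entries of x_a⁻¹·g lie in z^{n₂}ℂ⟦z⟧ if and only if n + l = −k and a ∈ 1 + z^kℂ⟦z⟧. -/

import Mathlib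

/-- The generator `z` of `ℂ⟦z⟧`, viewed inside the field of Laurent series `ℂ((z))`. -/
noncomputable def z : LaurentSeries ℂ := ((PowerSeries.X : PowerSeries ℂ) : LaurentSeries ℂ)

lemma z_ne_zero : z ≠ 0 := by
  simp [z]

lemma z_pow_toNat {k : ℤ} (hk : 0 ≤ k) :
    ((PowerSeries.X ^ k.toNat : PowerSeries ℂ) : LaurentSeries ℂ) = z ^ k := by
  obtain ⟨n, rfl⟩ := Int.eq_ofNat_of_zero_le hk
  simp [z]

lemma exponent_eq_zero_of_z_zpow_eq_coe {d : ℤ} {u : PowerSeries ℂ}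
    (hu : PowerSeries.constantCoeff u ≠ 0) (h : z ^ d = (u : LaurentSeries ℂ)) : d = 0 := by
  by_contra hd
  have h0 := congrArg (fun f : LaurentSeries ℂ => f.coeff 0) h
  rw [z, PowerSeries.coe_X, ← RatFunc.single_zpow] at h0
  simp only [PowerSeries.coeff_coe, HahnSeries.coeff_single_of_ne (Ne.symm hd)] at h0
  exact hu (by simpa using h0.symm)

/-- For a unit `a` and `k > 0`, `z ^ d - a ∈ z ^ k ℂ⟦z⟧` iff `d = 0` and `a ∈ 1 + z ^ k ℂ⟦z⟧`. -/
lemma exists_z_zpow_sub_unit_eq_iff {k : ℤ} (hk : 0 < k) (d : ℤ) (a : (PowerSeries ℂ)ˣ) :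
    (∃ p : PowerSeries ℂ, z ^ d - ((a : PowerSeries ℂ) : LaurentSeries ℂ) =
        z ^ k * (p : LaurentSeries ℂ)) ↔
      d = 0 ∧ (PowerSeries.X : PowerSeries ℂ) ^ k.toNat ∣ (a : PowerSeries ℂ) - 1 := by
  rw [← z_pow_toNat hk.le]
  constructor
  · rintro ⟨p, hp⟩
    have hz : z ^ d = (((a : PowerSeries ℂ) + PowerSeries.X ^ k.toNat * p : PowerSeries ℂ) :
        LaurentSeries ℂ) := by
      rw [PowerSeries.coe_add, PowerSeries.coe_mul, ← hp]
      ring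
    have hd : d = 0 := by
      refine exponent_eq_zero_of_z_zpow_eq_coe ?_ hz
      have hk' : k.toNat ≠ 0 := by omega
      simpa [hk'] using (a.isUnit.map PowerSeries.constantCoeff).ne_zero
    subst hd
    refine ⟨rfl, -p, ?_⟩
    rw [zpow_zero, ← PowerSeries.coe_one] at hz
    have := HahnSeries.ofPowerSeries_injective hz
    linear_combination -this
  · rintro ⟨rfl, p, hp⟩
    refine ⟨-p, ?_⟩
    rw [← PowerSeries.coe_mul, mul_neg, ← hp, neg_sub, PowerSeries.coe_sub, PowerSeries.coe_one,
      zpow_zero]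

lemma inv_upper_triangular_one {K : Type*} [Field K] {x : K} (hx : x ≠ 0) (y : K) :
    (!![x, y; 0, 1] : Matrix (Fin 2) (Fin 2) K)⁻¹ = !![x⁻¹, -(x⁻¹ * y); 0, 1] := by
  apply Matrix.inv_eq_right_inv
  ext i j
  fin_cases i <;> fin_cases j <;> simp [Matrix.mul_apply, hx]

/-- Let `k > 0`, `n₁ ≥ n₂`, `n = n₁ + n₂`, `m = -n₂`, `l` an integer and `a ∈ ℂ⟦z⟧ˣ`.
With `x_a = [[z^{-n}, a z^{-n-k}], [0, 1]]` and `g = [[z^m, z^{l-m}], [0, z^{-m}]]`, we have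
`x_a⁻¹ g = [[z^{n+m}, z^{n+l-m} - a z^{-k-m}], [0, z^{-m}]]`, and all entries of `x_a⁻¹ g`
lie in `z^{n₂}ℂ⟦z⟧` iff `n + l = -k` and `a ∈ 1 + z^k ℂ⟦z⟧`. -/
theorem stalk_computation (k n₁ n₂ l : ℤ) (hk : 0 < k) (h : n₂ ≤ n₁)
    (a : (PowerSeries ℂ)ˣ) :
    letI n : ℤ := n₁ + n₂
    letI m : ℤ := -n₂
    letI xa : Matrix (Fin 2) (Fin 2) (LaurentSeries ℂ) :=
      !![z ^ (-n), ((a : PowerSeries ℂ) : LaurentSeries ℂ) * z ^ (-n - k); 0, 1]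
    letI g : Matrix (Fin 2) (Fin 2) (LaurentSeries ℂ) :=
      !![z ^ m, z ^ (l - m); 0, z ^ (-m)]
    xa⁻¹ * g =
      !![z ^ (n + m),
          z ^ (n + l - m) - ((a : PowerSeries ℂ) : LaurentSeries ℂ) * z ^ (-k - m);
          0, z ^ (-m)] ∧
    ((∀ i j : Fin 2, ∃ p : PowerSeries ℂ,
        (xa⁻¹ * g) i j = z ^ n₂ * (p : LaurentSeries ℂ)) ↔
      (n + l = -k ∧
        (PowerSeries.X : PowerSeries ℂ) ^ k.toNat ∣ ((a : PowerSeries ℂ) - 1))) := by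
  have hz := z_ne_zero
  have hmul : (!![z ^ (-(n₁ + n₂)), ((a : PowerSeries ℂ) : LaurentSeries ℂ) *
        z ^ (-(n₁ + n₂) - k); 0, 1] : Matrix (Fin 2) (Fin 2) (LaurentSeries ℂ))⁻¹ *
      !![z ^ (-n₂), z ^ (l - -n₂); 0, z ^ (- -n₂)] =
      !![z ^ (n₁ + n₂ + -n₂),
        z ^ (n₁ + n₂ + l - -n₂) - ((a : PowerSeries ℂ) : LaurentSeries ℂ) * z ^ (-k - -n₂);
        0, z ^ (- -n₂)] := by
    rw [inv_upper_triangular_one (zpow_ne_zero _ hz)]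
    ext1 i j
    fin_cases i <;> fin_cases j <;>
      simp [Matrix.mul_apply, zpow_add₀ hz, zpow_sub₀ hz, zpow_neg] <;> field_simp <;> ring
  refine ⟨hmul, ?_⟩
  rw [hmul]
  have hcorner : (∃ p : PowerSeries ℂ, z ^ (n₁ + n₂ + l - -n₂) -
        ((a : PowerSeries ℂ) : LaurentSeries ℂ) * z ^ (-k - -n₂) =
          z ^ n₂ * (p : LaurentSeries ℂ)) ↔
      n₁ + n₂ + l = -k ∧
        (PowerSeries.X : PowerSeries ℂ) ^ k.toNat ∣ (a : PowerSeries ℂ) - 1 := by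
    rw [← add_eq_zero_iff_eq_neg, ← exists_z_zpow_sub_unit_eq_iff hk]
    refine exists_congr fun p => ?_
    rw [← mul_right_inj' (zpow_ne_zero (k - n₂) hz), mul_sub, mul_left_comm,
      ← mul_assoc (z ^ (k - n₂)) (z ^ n₂), ← zpow_add₀ hz, ← zpow_add₀ hz, ← zpow_add₀ hz]
    ring_nf
    simp
  rw [← hcorner]
  refine ⟨fun H => H 0 1, fun H i j => ?_⟩
  fin_cases i <;> fin_cases j
  · refine ⟨PowerSeries.X ^ (n₁ - n₂).toNat, ?_⟩
    rw [z_pow_toNat (by omega), ← zpow_add₀ hz]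
    simp
  · exact H
  · exact ⟨0, by simp⟩
  · exact ⟨1, by simp⟩
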